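/- A sequent Γ ⇒ Δ is derivable in the sequent calculus Go_Seq extended with the cut rule if and only if the formula (⋀Γ) → (⋁Δ) is derivable in the Hilbert-style system for the weak Grzegorczyk modal logic Go. -/

import Mathlib

inductive Formula : Type
  | atom : ℕ → Formula
  | bot  : Formula
  | imp  : Formula → Formula → Formula
  | box  : Formula → Formula
deriving DecidableEq

def boxtimes (Γ : Multiset Formula) : Multiset Formula := Γ + Γ.map Formula.box

inductive GoSeq : Bool → Multiset Formula → Multiset Formula → Prop
  | ax (c) (Γ Δ : Multiset Formula) (A : Formula) : GoSeq c (A ::ₘ Γ) (A ::ₘ Δ)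
  | axBot (c) (Γ Δ : Multiset Formula) : GoSeq c (Formula.bot ::ₘ Γ) Δ
  | impL (c) (Γ Δ : Multiset Formula) (A B : Formula) :
      GoSeq c (B ::ₘ Γ) Δ → GoSeq c Γ (A ::ₘ Δ) → GoSeq c ((A.imp B) ::ₘ Γ) Δ
  | impR (c) (Γ Δ : Multiset Formula) (A B : Formula) :
      GoSeq c (A ::ₘ Γ) (B ::ₘ Δ) → GoSeq c Γ ((A.imp B) ::ₘ Δ)
  | boxGo (c) (Γ Δ Θ : Multiset Formula) (A : Formula) :
      GoSeq c ((Formula.box (A.imp (Formula.box A))) ::ₘ boxtimes Θ) {A} →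
      GoSeq c (Γ + Θ.map Formula.box) ((Formula.box A) ::ₘ Δ)
  | cut (Γ Δ : Multiset Formula) (A : Formula) :
      GoSeq true Γ (A ::ₘ Δ) → GoSeq true (A ::ₘ Γ) Δ → GoSeq true Γ Δ


def Formula.evalB : (Formula → Bool) → Formula → Bool
  | v, .atom n => v (.atom n)
  | _, .bot => false
  | v, .imp A B => !(Formula.evalB v A) || Formula.evalB v B
  | v, .box A => v (.box A)

def Tautology (A : Formula) : Prop := ∀ v : Formula → Bool, Formula.evalB v A = true

inductive GoHilbert : Formula → Prop
  | taut {A : Formula} : Tautology A → GoHilbert A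
  | axK (A B : Formula) :
      GoHilbert ((Formula.box (A.imp B)).imp ((Formula.box A).imp (Formula.box B)))
  | ax4 (A : Formula) : GoHilbert ((Formula.box A).imp (Formula.box (Formula.box A)))
  | axGo (A : Formula) :
      GoHilbert ((Formula.box ((Formula.box (A.imp (Formula.box A))).imp A)).imp (Formula.box A))
  | mp {A B : Formula} : GoHilbert (A.imp B) → GoHilbert A → GoHilbert B
  | nec {A : Formula} : GoHilbert A → GoHilbert (Formula.box A)

def negF (A : Formula) : Formula := A.imp .bot
def conjF (A B : Formula) : Formula := (A.imp (negF B)).imp .bot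
def disjF (A B : Formula) : Formula := (negF A).imp B
def conjList (l : List Formula) : Formula := l.foldr conjF (negF .bot)
def disjList (l : List Formula) : Formula := l.foldr disjF .bot

/-- A valuation satisfies a sequent if truth of the antecedent forces some succedent formula. -/
def SatisfiesSeq (v : Formula → Bool) (Γ Δ : Multiset Formula) : Prop :=
  (∀ A ∈ Γ, A.evalB v = true) → ∃ A ∈ Δ, A.evalB v = true

/-- A sequent is a propositional consequence of finitely many Hilbert theorems. -/
def HilbertSeq (Γ Δ : Multiset Formula) : Prop :=
  ∃ L : List Formula, (∀ A ∈ L, GoHilbert A) ∧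
    ∀ v, (∀ A ∈ L, Formula.evalB v A = true) → SatisfiesSeq v Γ Δ

lemma evalB_imp_iff (v : Formula → Bool) (A B : Formula) :
    (A.imp B).evalB v = true ↔ (A.evalB v = true → B.evalB v = true) := by
  simp only [Formula.evalB]
  cases A.evalB v <;> simp

lemma evalB_bot_iff (v : Formula → Bool) : Formula.bot.evalB v = true ↔ False := by
  simp [Formula.evalB]

lemma evalB_foldr_imp_iff (v : Formula → Bool) (l : List Formula) (A : Formula) :
    (l.foldr Formula.imp A).evalB v = true ↔
      ((∀ B ∈ l, B.evalB v = true) → A.evalB v = true) := by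
  induction l with
  | nil => simp
  | cons B l ih => simp [evalB_imp_iff, ih]

lemma evalB_conjList_iff (v : Formula → Bool) (l : List Formula) :
    (conjList l).evalB v = true ↔ ∀ B ∈ l, B.evalB v = true := by
  induction l with
  | nil => simp [conjList, negF, evalB_imp_iff]
  | cons B l ih =>
    have : conjList (B :: l) = conjF B (conjList l) := rfl
    simp [this, conjF, negF, evalB_imp_iff, evalB_bot_iff, ih]

lemma evalB_disjList_iff (v : Formula → Bool) (l : List Formula) :
    (disjList l).evalB v = true ↔ ∃ B ∈ l, B.evalB v = true := by
  induction l with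
  | nil => simp [disjList, evalB_bot_iff]
  | cons B l ih =>
    have : disjList (B :: l) = disjF B (disjList l) := rfl
    simp only [this, disjF, negF, evalB_imp_iff, evalB_bot_iff, ih, List.exists_mem_cons_iff]
    tauto

lemma satisfiesSeq_coe_iff (v : Formula → Bool) (Γ Δ : List Formula) :
    SatisfiesSeq v ↑Γ ↑Δ ↔ ((conjList Γ).imp (disjList Δ)).evalB v = true := by
  simp [SatisfiesSeq, evalB_imp_iff, evalB_conjList_iff, evalB_disjList_iff]

lemma goHilbert_of_foldr_imp {L : List Formula} {A : Formula} (hL : ∀ B ∈ L, GoHilbert B)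
    (h : GoHilbert (L.foldr Formula.imp A)) : GoHilbert A := by
  induction L with
  | nil => exact h
  | cons B L ih =>
    exact ih (fun C hC => hL C (by simp [hC])) (.mp h (hL B (by simp)))

lemma goHilbert_of_consequence {L : List Formula} {A : Formula} (hL : ∀ B ∈ L, GoHilbert B)
    (h : ∀ v, (∀ B ∈ L, Formula.evalB v B = true) → A.evalB v = true) : GoHilbert A :=
  goHilbert_of_foldr_imp hL (.taut fun v => (evalB_foldr_imp_iff v L A).2 (h v))

lemma hilbertSeq_coe_iff (Γ Δ : List Formula) :
    HilbertSeq ↑Γ ↑Δ ↔ GoHilbert ((conjList Γ).imp (disjList Δ)) := by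
  constructor
  · rintro ⟨L, hL, h⟩
    exact goHilbert_of_consequence hL fun v hv => (satisfiesSeq_coe_iff v Γ Δ).1 (h v hv)
  · intro h
    exact ⟨[_], by simpa using h, fun v hv => (satisfiesSeq_coe_iff v Γ Δ).2 (hv _ (by simp))⟩

lemma HilbertSeq.of_two {Γ Γ₁ Γ₂ Δ Δ₁ Δ₂ : Multiset Formula} (h₁ : HilbertSeq Γ₁ Δ₁)
    (h₂ : HilbertSeq Γ₂ Δ₂)
    (h : ∀ v, SatisfiesSeq v Γ₁ Δ₁ → SatisfiesSeq v Γ₂ Δ₂ → SatisfiesSeq v Γ Δ) :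
    HilbertSeq Γ Δ := by
  obtain ⟨L₁, hL₁, h₁⟩ := h₁
  obtain ⟨L₂, hL₂, h₂⟩ := h₂
  refine ⟨L₁ ++ L₂, ?_, fun v hv => h v (h₁ v ?_) (h₂ v ?_)⟩
  · intro A hA
    exact (List.mem_append.1 hA).elim (hL₁ A) (hL₂ A)
  · exact fun A hA => hv A (by simp [hA])
  · exact fun A hA => hv A (by simp [hA])

lemma HilbertSeq.of_satisfies {Γ Δ : Multiset Formula} (h : ∀ v, SatisfiesSeq v Γ Δ) :
    HilbertSeq Γ Δ :=
  ⟨[], by simp, fun v _ => h v⟩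

lemma hilbertSeq_box_foldr_imp (l : List Formula) (A : Formula) :
    HilbertSeq ((l.foldr Formula.imp A).box ::ₘ ↑(l.map Formula.box)) {A.box} := by
  induction l with
  | nil => exact .of_satisfies fun v => by simp [SatisfiesSeq]
  | cons B l ih =>
    have hK : HilbertSeq 0
        {(B.imp (l.foldr Formula.imp A)).box.imp (B.box.imp (l.foldr Formula.imp A).box)} :=
      ⟨[_], by simpa using GoHilbert.axK B (l.foldr Formula.imp A),
        fun v hv => by simpa [SatisfiesSeq] using hv⟩
    refine ih.of_two hK fun v => ?_
    simp [SatisfiesSeq, evalB_imp_iff]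
    tauto

lemma hilbertSeq_boxGo {Θ : Multiset Formula} {A : Formula}
    (h : HilbertSeq ((A.imp A.box).box ::ₘ boxtimes Θ) {A}) :
    HilbertSeq (Θ.map Formula.box) {A.box} := by
  obtain ⟨l, rfl⟩ : ∃ l : List Formula, Θ = l := ⟨Θ.toList, by simp⟩
  set G := (A.imp A.box).box.imp A with hG
  set F := (l ++ l.map Formula.box).foldr Formula.imp G with hF
  have hF' : GoHilbert F := by
    obtain ⟨L, hL, h⟩ := h
    refine goHilbert_of_consequence hL fun v hv => ?_
    rw [hF, evalB_foldr_imp_iff, hG, evalB_imp_iff]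
    intro h₁ h₂
    have := h v hv
    simp only [SatisfiesSeq, Multiset.mem_singleton, exists_eq_left] at this
    refine this fun B hB => ?_
    rcases Multiset.mem_cons.1 hB with rfl | hB
    · exact h₂
    · exact h₁ B (by simpa [boxtimes] using hB)
  obtain ⟨L, hL, h⟩ := hilbertSeq_box_foldr_imp (l ++ l.map Formula.box) G
  refine ⟨F.box :: G.box.imp A.box :: (L ++ l.map fun B => B.box.imp B.box.box), ?_,
    fun v hv hΘ => ?_⟩
  · simp only [List.mem_cons, List.mem_append, List.mem_map]
    rintro B (rfl | rfl | hB | ⟨C, -, rfl⟩)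
    · exact hF'.nec
    · exact GoHilbert.axGo A
    · exact hL B hB
    · exact GoHilbert.ax4 C
  · have hGo := (evalB_imp_iff v _ _).1 (hv (G.box.imp A.box) (by simp))
    have h4 : ∀ B ∈ l, B.box.box.evalB v = true := fun B hB =>
      (evalB_imp_iff v _ _).1 (hv (B.box.imp B.box.box) (by simp; grind))
        (hΘ _ (Multiset.mem_map_of_mem _ hB))
    refine ⟨A.box, by simp, hGo ?_⟩
    have := h v (fun B hB => hv B (by simp [hB]))
    simp only [SatisfiesSeq, Multiset.mem_singleton, exists_eq_left] at this
    refine this fun B hB => ?_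
    simp only [Multiset.mem_cons, Multiset.mem_coe, List.mem_map, List.mem_append] at hB
    rcases hB with rfl | ⟨C, hC | ⟨D, hD, rfl⟩, rfl⟩
    · exact hv _ (List.mem_cons_self ..)
    · exact hΘ _ (Multiset.mem_map_of_mem _ hC)
    · exact h4 D hD

lemma HilbertSeq.of_goSeq {c : Bool} {Γ Δ : Multiset Formula} (h : GoSeq c Γ Δ) :
    HilbertSeq Γ Δ := by
  induction h with
  | ax c Γ Δ A => exact .of_satisfies fun v => by simp [SatisfiesSeq]; tauto
  | axBot c Γ Δ => exact .of_satisfies fun v => by simp [SatisfiesSeq, evalB_bot_iff]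
  | impL c Γ Δ A B _ _ ih₁ ih₂ =>
    refine ih₁.of_two ih₂ fun v => ?_
    simp only [SatisfiesSeq, Multiset.mem_cons, forall_eq_or_imp, exists_eq_or_imp, evalB_imp_iff]
    tauto
  | impR c Γ Δ A B _ ih =>
    refine ih.of_two ih fun v => ?_
    simp only [SatisfiesSeq, Multiset.mem_cons, forall_eq_or_imp, exists_eq_or_imp, evalB_imp_iff]
    tauto
  | boxGo c Γ Δ Θ A _ ih =>
    have ih := hilbertSeq_boxGo ih
    refine ih.of_two ih fun v h _ hΓ => ?_
    obtain ⟨B, hB, hv⟩ := h fun B hB => hΓ B (Multiset.mem_add.2 (.inr hB))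
    exact ⟨B, by simp_all, hv⟩
  | cut Γ Δ A _ _ ih₁ ih₂ =>
    refine ih₁.of_two ih₂ fun v => ?_
    simp only [SatisfiesSeq, Multiset.mem_cons, forall_eq_or_imp, exists_eq_or_imp]
    tauto

lemma GoSeq.weaken {c : Bool} {Γ Δ : Multiset Formula} (h : GoSeq c Γ Δ)
    (Γ' Δ' : Multiset Formula) : GoSeq c (Γ + Γ') (Δ + Δ') := by
  induction h with
  | ax c Γ Δ A => simpa using GoSeq.ax c (Γ + Γ') (Δ + Δ') A
  | axBot c Γ Δ => simpa using GoSeq.axBot c (Γ + Γ') (Δ + Δ')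
  | impL c Γ Δ A B _ _ ih₁ ih₂ =>
    rw [Multiset.cons_add]
    exact .impL c _ _ A B (by simpa using ih₁) (by simpa using ih₂)
  | impR c Γ Δ A B _ ih =>
    rw [Multiset.cons_add]
    exact .impR c _ _ A B (by simpa using ih)
  | boxGo c Γ Δ Θ A h _ =>
    rw [Multiset.cons_add, add_right_comm]
    exact .boxGo c _ _ Θ A h
  | cut Γ Δ A _ _ ih₁ ih₂ => exact .cut _ _ A (by simpa using ih₁) (by simpa using ih₂)

lemma GoSeq.of_mem {c : Bool} {Γ Δ : Multiset Formula} {A : Formula} (hΓ : A ∈ Γ) (hΔ : A ∈ Δ) :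
    GoSeq c Γ Δ := by
  obtain ⟨Γ, rfl⟩ := Multiset.exists_cons_of_mem hΓ
  obtain ⟨Δ, rfl⟩ := Multiset.exists_cons_of_mem hΔ
  exact .ax c Γ Δ A

/-- The number of implications of a formula outside the scope of `box`. -/
def Formula.impCount : Formula → ℕ
  | .imp A B => A.impCount + B.impCount + 1
  | _ => 0

lemma Formula.impCount_imp (A B : Formula) :
    (A.imp B).impCount = A.impCount + B.impCount + 1 := rfl

lemma GoSeq.of_satisfies {c : Bool} {Γ Δ : Multiset Formula} (h : ∀ v, SatisfiesSeq v Γ Δ) :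
    GoSeq c Γ Δ := by
  induction hn : (Γ.map Formula.impCount).sum + (Δ.map Formula.impCount).sum using
    Nat.strong_induction_on generalizing Γ Δ with
  | _ n ih =>
  subst hn
  by_cases hL : ∃ A B : Formula, A.imp B ∈ Γ
  · obtain ⟨A, B, hAB⟩ := hL
    obtain ⟨Γ, rfl⟩ := Multiset.exists_cons_of_mem hAB
    refine .impL c Γ Δ A B (ih _ ?_ (fun v => ?_) rfl) (ih _ ?_ (fun v => ?_) rfl)
    · simp [Formula.impCount_imp]
    · have := h v
      simp only [SatisfiesSeq, Multiset.mem_cons, forall_eq_or_imp, evalB_imp_iff] at this ⊢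
      tauto
    · simp [Formula.impCount_imp]
      omega
    · have := h v
      simp only [SatisfiesSeq, Multiset.mem_cons, forall_eq_or_imp, exists_eq_or_imp,
        evalB_imp_iff] at this ⊢
      tauto
  by_cases hR : ∃ A B : Formula, A.imp B ∈ Δ
  · obtain ⟨A, B, hAB⟩ := hR
    obtain ⟨Δ, rfl⟩ := Multiset.exists_cons_of_mem hAB
    refine .impR c Γ Δ A B (ih _ ?_ (fun v => ?_) rfl)
    · simp [Formula.impCount_imp]
      omega
    · have := h v
      simp only [SatisfiesSeq, Multiset.mem_cons, forall_eq_or_imp, exists_eq_or_imp,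
        evalB_imp_iff] at this ⊢
      tauto
  by_cases hbot : Formula.bot ∈ Γ
  · obtain ⟨Γ, rfl⟩ := Multiset.exists_cons_of_mem hbot
    exact .axBot c Γ Δ
  obtain ⟨A, hA, hv⟩ := h (fun A => decide (A ∈ Γ)) fun A hA => by
    cases A with
    | atom n => simpa [Formula.evalB] using hA
    | bot => exact absurd hA hbot
    | imp A B => exact absurd ⟨A, B, hA⟩ hL
    | box A => simpa [Formula.evalB] using hA
  refine .of_mem ?_ hA
  cases A with
  | atom n => simpa [Formula.evalB] using hv
  | bot => simp [Formula.evalB] at hv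
  | imp A B => exact absurd ⟨A, B, hA⟩ hR
  | box A => simpa [Formula.evalB] using hv

lemma GoHilbert.goSeq {A : Formula} (h : GoHilbert A) : GoSeq true 0 {A} := by
  induction h with
  | taut h => exact .of_satisfies fun v => by simpa [SatisfiesSeq] using h v
  | axK A B =>
    refine .impR true 0 0 _ _ (.impR true _ 0 _ _ ?_)
    have hprem : GoSeq true ((B.imp B.box).box ::ₘ boxtimes {A.imp B, A}) {B} := by
      refine .of_satisfies fun v => ?_
      simp [SatisfiesSeq, boxtimes, evalB_imp_iff]
      tauto
    have := GoSeq.boxGo true 0 0 {A.imp B, A} B hprem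
    rwa [zero_add, Multiset.insert_eq_cons, Multiset.map_cons, Multiset.map_singleton,
      ← Multiset.cons_zero, Multiset.cons_swap] at this
  | ax4 A =>
    refine .impR true 0 0 _ _ ?_
    have hprem : GoSeq true ((A.box.imp A.box.box).box ::ₘ boxtimes {A}) {A.box} :=
      .of_mem (A := A.box) (by simp [boxtimes]) (by simp)
    simpa using GoSeq.boxGo true 0 0 {A} A.box hprem
  | axGo A =>
    refine .impR true 0 0 _ _ ?_
    have hprem : GoSeq true ((A.imp A.box).box ::ₘ boxtimes {(A.imp A.box).box.imp A}) {A} := by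
      refine .of_satisfies fun v => ?_
      simp only [SatisfiesSeq, boxtimes, Multiset.mem_cons, Multiset.mem_add,
        Multiset.mem_singleton, exists_eq_left]
      exact fun h => (evalB_imp_iff v _ _).1 (h _ (.inr (.inl rfl))) (h _ (.inl rfl))
    simpa using GoSeq.boxGo true 0 0 {(A.imp A.box).box.imp A} A hprem
  | @mp A B _ _ ih₁ ih₂ =>
    refine .cut _ _ A (by simpa using ih₂.weaken 0 {B}) (.cut _ _ (A.imp B) ?_ ?_)
    · simpa using ih₁.weaken {A} {B}
    · exact .of_satisfies fun v => by simp [SatisfiesSeq, evalB_imp_iff]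
  | @nec A _ ih =>
    simpa using GoSeq.boxGo true 0 0 0 A
      (by simpa [boxtimes] using ih.weaken {(A.imp A.box).box} 0)

lemma GoSeq.of_add_left {Γ Δ : Multiset Formula} {L : List Formula}
    (hL : ∀ A ∈ L, GoHilbert A) (h : GoSeq true (↑L + Γ) Δ) : GoSeq true Γ Δ := by
  induction L with
  | nil => simpa using h
  | cons A L ih =>
    refine ih (fun B hB => hL B (by simp [hB])) (.cut _ _ A ?_ ?_)
    · simpa using (hL A (by simp)).goSeq.weaken (↑L + Γ) Δ
    · simpa [← Multiset.cons_coe] using h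

lemma HilbertSeq.goSeq {Γ Δ : Multiset Formula} (h : HilbertSeq Γ Δ) : GoSeq true Γ Δ := by
  obtain ⟨L, hL, h⟩ := h
  refine .of_add_left hL (.of_satisfies fun v hv => ?_)
  exact h v (fun A hA => hv A (by simp [hA])) fun A hA => hv A (by simp [hA])

theorem stmt0 (Γ Δ : List Formula) :
    GoSeq true (↑Γ : Multiset Formula) (↑Δ : Multiset Formula) ↔
      GoHilbert ((conjList Γ).imp (disjList Δ)) := by
  rw [← hilbertSeq_coe_iff]
  exact ⟨.of_goSeq, HilbertSeq.goSeq⟩
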